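/- arXiv:2310.06513 — 2 statements merged into one kernel-verified Lean document; each statement's English description precedes it below -/
import Mathlib

section
/- Let (Ω, μ) be a probability space and let E₁, E₂, E₃ be measurable events that are mutually independent (the family ![E₁, E₂, E₃] satisfies ProbabilityTheory.iIndepSet with respect to μ). Write P₁ = μ E₁, P₂ = μ E₂, P₃ = μ E₃ (as real numbers). Then μ ((E₁ ∩ E₂ ∩ E₃) ∪ ((E₁ ∩ E₂)ᶜ ∩ E₃ᶜ)) = P₁·P₂·P₃ + (1 − P₃)·(1 − P₁·P₂). -/
open MeasureTheory ProbabilityTheory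

/-- Proposition 4.2: the probability that transitivity holds for three mutually
independent aggregation events `E₁, E₂, E₃` equals
`P₁·P₂·P₃ + (1 − P₃)·(1 − P₁·P₂)`. -/
theorem prob_transitivity {Ω : Type*} [MeasurableSpace Ω] (μ : Measure Ω)
    [IsProbabilityMeasure μ] (E₁ E₂ E₃ : Set Ω)
    (h₁ : MeasurableSet E₁) (h₂ : MeasurableSet E₂) (h₃ : MeasurableSet E₃)
    (hind : iIndepSet ![E₁, E₂, E₃] μ) :
    (μ ((E₁ ∩ E₂ ∩ E₃) ∪ ((E₁ ∩ E₂)ᶜ ∩ E₃ᶜ))).toReal =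
      (μ E₁).toReal * (μ E₂).toReal * (μ E₃).toReal +
        (1 - (μ E₃).toReal) * (1 - (μ E₁).toReal * (μ E₂).toReal) := by
  have h₁₂ : μ.real (E₁ ∩ E₂) = μ.real E₁ * μ.real E₂ := by
    have h := hind.meas_biInter {0, 1}
    simp only [Finset.set_biInter_insert, Finset.set_biInter_singleton] at h
    rw [Finset.prod_pair (by decide)] at h
    simpa [Measure.real] using congrArg ENNReal.toReal h
  have h₁₂₃ : μ.real (E₁ ∩ E₂ ∩ E₃) = μ.real E₁ * μ.real E₂ * μ.real E₃ := by
    have h := hind.meas_biInter {0, 1, 2}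
    simp only [Finset.set_biInter_insert, Finset.set_biInter_singleton] at h
    rw [Finset.prod_insert (by decide), Finset.prod_pair (by decide)] at h
    simpa [Measure.real, Set.inter_assoc, mul_assoc] using congrArg ENNReal.toReal h
  have hunion := measureReal_union_add_inter (μ := μ) (s := E₁ ∩ E₂) h₃
  have hcompl := probReal_compl_eq_one_sub (μ := μ) ((h₁.inter h₂).union h₃)
  have hdisj : Disjoint (E₁ ∩ E₂ ∩ E₃) (E₁ ∩ E₂ ∪ E₃)ᶜ :=
    Set.disjoint_compl_right_iff_subset.mpr fun _ hx ↦ Or.inr hx.2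
  rw [← Set.compl_union]
  simp only [← measureReal_def]
  rw [measureReal_union hdisj ((h₁.inter h₂).union h₃).compl, hcompl]
  linear_combination 2 * h₁₂₃ - h₁₂ - hunion
end

section
/- Let A ≥ 2 and N ≥ 1 be natural numbers, let ζ ≥ 0 be a real number, and let k ≤ A − 1 be the number of aggregated path pairs. For each j < k, let l_j be a natural number with (A : ℝ)^{l_j} ≤ N + 1, and let V₁^j, V₂^j : Fin (l_j) → ℝ be value sequences with |V₁^j i − V₂^j i| ≤ ζ for every i. Then the total aggregation error satisfies ∑_{j < k} ∑_{i} |V₁^j i − V₂^j i| ≤ (A − 1) · Real.logb A (N + 1) · ζ. -/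
/-- Non-transitive case of Theorem 4.3: with at most `A − 1` aggregated path
pairs, each of length `l j` with `A^(l j) ≤ N + 1` and per-node value loss at
most `ζ`, the total aggregation error is bounded by `(A − 1) · log_A (N + 1) · ζ`. -/
theorem aggregation_error_nontransitive (A N : ℕ) (hA : 2 ≤ A) (hN : 1 ≤ N)
    (ζ : ℝ) (hζ : 0 ≤ ζ) (k : ℕ) (hk : k ≤ A - 1)
    (l : Fin k → ℕ) (hl : ∀ j, (A : ℝ) ^ (l j) ≤ N + 1)
    (V₁ V₂ : (j : Fin k) → Fin (l j) → ℝ)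
    (h : ∀ j i, |V₁ j i - V₂ j i| ≤ ζ) :
    ∑ j, ∑ i, |V₁ j i - V₂ j i| ≤ ((A : ℝ) - 1) * Real.logb A (N + 1) * ζ := by
  have hA1 : (1 : ℝ) < A := by exact_mod_cast hA
  have hN1 : (0 : ℝ) < N + 1 := by positivity
  have hlog : 0 ≤ Real.logb A (N + 1) :=
    Real.logb_nonneg hA1 (by linarith [Nat.cast_nonneg (α := ℝ) N])
  have length_le (j : Fin k) : (l j : ℝ) ≤ Real.logb A (N + 1) := by
    rw [Real.le_logb_iff_rpow_le hA1 hN1, Real.rpow_natCast]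
    exact hl j
  have path_le (j : Fin k) : ∑ i, |V₁ j i - V₂ j i| ≤ Real.logb A (N + 1) * ζ :=
    calc ∑ i, |V₁ j i - V₂ j i| ≤ ∑ _i : Fin (l j), ζ := Finset.sum_le_sum fun i _ => h j i
      _ = l j * ζ := by simp
      _ ≤ Real.logb A (N + 1) * ζ := mul_le_mul_of_nonneg_right (length_le j) hζ
  have hkA : (k : ℝ) ≤ A - 1 := by
    have : k + 1 ≤ A := by omega
    rw [le_sub_iff_add_le]
    exact_mod_cast this
  calc ∑ j, ∑ i, |V₁ j i - V₂ j i| ≤ ∑ _j : Fin k, Real.logb A (N + 1) * ζ :=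
        Finset.sum_le_sum fun j _ => path_le j
    _ = k * (Real.logb A (N + 1) * ζ) := by simp
    _ ≤ ((A : ℝ) - 1) * (Real.logb A (N + 1) * ζ) :=
        mul_le_mul_of_nonneg_right hkA (mul_nonneg hlog hζ)
    _ = ((A : ℝ) - 1) * Real.logb A (N + 1) * ζ := (mul_assoc _ _ _).symm
end
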